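/- Let r₁, r₂, m be integers with 0 < r₁ < r₂ < r₁ + r₂ ≤ m and r₁ even. Let C and D be sets of nonnegative integers such that C ∪ D = [0, m], C ∩ D = {r₁, r₂}, and 0 ∈ C. If R_C(n) = R_D(n) for every integer n ∈ [0, m], then r₁ ≡ 2 (mod 4) and r₂ ≡ 3 (mod 4). -/

import Mathlib

/-- `R S n` is the number of pairs `(s, s')` with `s, s' ∈ S`, `s < s'` and `s + s' = n`. -/
noncomputable def R (S : Set ℕ) (n : ℕ) : ℕ :=
  Set.ncard {p : ℕ × ℕ | p.1 ∈ S ∧ p.2 ∈ S ∧ p.1 < p.2 ∧ p.1 + p.2 = n}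

/-- `AP r m` is the arithmetic progression `r + mℕ = {r + m*k : k ∈ ℕ}`. -/
def AP (r m : ℕ) : Set ℕ := {n | ∃ k : ℕ, n = r + m * k}

/-- The Thue–Morse sequence with values `±1`. -/
def thueMorse (n : ℕ) : ℤ :=
  if n = 0 then 1 else if n % 2 = 0 then thueMorse (n / 2) else -thueMorse (n / 2)
termination_by n
decreasing_by all_goals omega

/-- The difference sequence of `thueMorse`, with initial value `1`. -/
def thueMorseDiff : ℕ → ℤ
  | 0 => 1
  | i + 1 => thueMorse (i + 1) - thueMorse i

theorem thueMorseDiff_succ (i : ℕ) :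
    thueMorseDiff (i + 1) = thueMorse (i + 1) - thueMorse i := rfl

namespace thueMorse

theorem zero : thueMorse 0 = 1 := by
  rw [thueMorse]; rfl

theorem two_mul (n : ℕ) : thueMorse (2 * n) = thueMorse n := by
  rcases Nat.eq_zero_or_pos n with rfl | hn
  · rfl
  · rw [thueMorse, if_neg (by omega), if_pos (by omega), Nat.mul_div_cancel_left n two_pos]

theorem two_mul_add_one (n : ℕ) : thueMorse (2 * n + 1) = -thueMorse n := by
  rw [thueMorse, if_neg (by omega), if_neg (by omega), show (2 * n + 1) / 2 = n by omega]

theorem one : thueMorse 1 = -1 := by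
  have h := two_mul_add_one 0
  rwa [zero] at h

theorem two : thueMorse 2 = -1 := by
  rw [← one, ← two_mul 1]

theorem eq_one_or (n : ℕ) : thueMorse n = 1 ∨ thueMorse n = -1 := by
  induction n using Nat.strong_induction_on with
  | _ n ih =>
    obtain ⟨k, rfl | rfl⟩ := Nat.even_or_odd' n
    · rw [two_mul]
      rcases Nat.eq_zero_or_pos k with rfl | hk
      · exact Or.inl zero
      · exact ih k (by omega)
    · rw [two_mul_add_one]
      have := ih k (by omega)
      omega

theorem succ_of_even {n : ℕ} (hn : Even n) : thueMorse (n + 1) = -thueMorse n := by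
  obtain ⟨k, rfl⟩ := hn.exists_two_nsmul
  rw [smul_eq_mul, two_mul_add_one, two_mul]

theorem pow_mul_add (v a x : ℕ) (hx : x < 2 ^ v) :
    thueMorse (2 ^ v * a + x) = thueMorse a * thueMorse x := by
  induction v generalizing x with
  | zero =>
    obtain rfl : x = 0 := by simpa using hx
    simp [zero]
  | succ v ih =>
    rw [pow_succ] at hx
    obtain ⟨y, rfl | rfl⟩ := Nat.even_or_odd' x
    · rw [show 2 ^ (v + 1) * a + 2 * y = 2 * (2 ^ v * a + y) by ring, two_mul, two_mul,
        ih y (by omega)]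
    · rw [show 2 ^ (v + 1) * a + (2 * y + 1) = 2 * (2 ^ v * a + y) + 1 by ring,
        two_mul_add_one, two_mul_add_one, ih y (by omega), mul_neg]

theorem pow_mul (v a : ℕ) : thueMorse (2 ^ v * a) = thueMorse a := by
  simpa [zero] using pow_mul_add v a 0 (by positivity)

theorem not_three_eq (l : ℕ) :
    ¬ (thueMorse l = thueMorse (l + 1) ∧ thueMorse (l + 1) = thueMorse (l + 2)) := by
  rintro ⟨h, h'⟩
  have := eq_one_or (l + 1)
  rcases Nat.even_or_odd l with hl | hl
  · have := succ_of_even hl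
    omega
  · have : thueMorse (l + 2) = _ := succ_of_even hl.add_one
    omega

end thueMorse

theorem thueMorseDiff_of_odd {i : ℕ} (hi : Odd i) : thueMorseDiff i = 2 * thueMorse i := by
  obtain ⟨k, rfl⟩ := hi
  rw [thueMorseDiff_succ, thueMorse.two_mul_add_one, thueMorse.two_mul]
  ring

/-- Two odd positions `i, i + 2` where shifting by `r` negates the sequence
are incompatible with an odd shift `k`. -/
theorem false_of_shift_neg {r k i : ℕ} (hk : Odd k) (hi : Odd i) (hki : k < i)
    (h₁ : thueMorse (r + i) - thueMorseDiff i - thueMorseDiff (i - k) = 1 ∨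
      thueMorse (r + i) - thueMorseDiff i - thueMorseDiff (i - k) = -1)
    (h₂ : thueMorse (r + (i + 2)) - thueMorseDiff (i + 2) - thueMorseDiff (i + 2 - k) = 1 ∨
      thueMorse (r + (i + 2)) - thueMorseDiff (i + 2) - thueMorseDiff (i + 2 - k) = -1)
    (hT₁ : thueMorse (r + i) = -thueMorse i)
    (hT₂ : thueMorse (r + (i + 2)) = -thueMorse (i + 2)) : False := by
  obtain ⟨l, hl⟩ : ∃ l, i - k = 2 * l + 1 + 1 := by
    obtain ⟨a, rfl⟩ := hk
    obtain ⟨b, rfl⟩ := hi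
    exact ⟨b - a - 1, by omega⟩
  rw [show i + 2 - k = 2 * (l + 1) + 1 + 1 by omega, hT₂,
    thueMorseDiff_of_odd (by grind), thueMorseDiff_succ, thueMorse.two_mul_add_one,
    show 2 * (l + 1) + 1 + 1 = 2 * (l + 2) by ring, thueMorse.two_mul] at h₂
  rw [hl, hT₁, thueMorseDiff_of_odd hi, thueMorseDiff_succ, thueMorse.two_mul_add_one,
    show 2 * l + 1 + 1 = 2 * (l + 1) by ring, thueMorse.two_mul] at h₁
  have := thueMorse.not_three_eq l
  have := thueMorse.eq_one_or l
  have := thueMorse.eq_one_or (l + 1)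
  have := thueMorse.eq_one_or (l + 2)
  have := thueMorse.eq_one_or i
  have := thueMorse.eq_one_or (i + 2)
  omega

/-- The constraints on `r` and `k` satisfied by the common elements `r, r + k`. -/
theorem shift_cases {r k : ℕ} (hr : 0 < r) (hk : 0 < k) (hev : Even r)
    (h0 : thueMorse r = 1)
    (hA : ∀ i, 0 < i → i < k → i < r →
      thueMorse (r + i) - thueMorseDiff i = 1 ∨ thueMorse (r + i) - thueMorseDiff i = -1)
    (hB : k < r → thueMorse (r + k) - thueMorseDiff k = 1)
    (hC : ∀ i, k < i → i < r →
      thueMorse (r + i) - thueMorseDiff i - thueMorseDiff (i - k) = 1 ∨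
      thueMorse (r + i) - thueMorseDiff i - thueMorseDiff (i - k) = -1) :
    (r % 4 = 2 ∧ k = 1) ∨ ∃ v, r = 2 ^ (v + 1) * 3 ∧ k = 2 ^ (v + 2) := by
  obtain ⟨v, u, hu, rfl⟩ := Nat.exists_eq_two_pow_mul_odd hr.ne'
  have hv : v ≠ 0 := by
    rintro rfl
    simp at hev
    exact (Nat.not_even_iff_odd.2 hu) hev
  obtain ⟨v, rfl⟩ := Nat.exists_eq_succ_of_ne_zero hv
  rw [Nat.succ_eq_add_one] at *
  rw [thueMorse.pow_mul] at h0
  have hu3 : 3 ≤ u := by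
    obtain ⟨w, rfl⟩ := hu
    rcases Nat.eq_zero_or_pos w with rfl | hw
    · simp [thueMorse.one] at h0
    · omega
  have hadd := fun a x ↦ thueMorse.pow_mul_add (v + 1) a x
  have hq2 : 2 ^ (v + 2) = 2 * 2 ^ (v + 1) := by ring
  have hqe : Even (2 ^ (v + 1)) := by simp [Nat.even_pow]
  have hq0 : 2 ≤ 2 ^ (v + 1) := by
    rw [pow_succ]; have := Nat.one_le_two_pow (n := v); omega
  have hq4 : v ≠ 0 → 4 ≤ 2 ^ (v + 1) := fun h ↦ by
    calc 4 = 2 ^ 2 := rfl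
      _ ≤ _ := Nat.pow_le_pow_right (by norm_num) (by omega)
  have hru : 2 ^ (v + 1) * 3 ≤ 2 ^ (v + 1) * u := Nat.mul_le_mul_left _ hu3
  have hpair : thueMorse (u + 2) = -thueMorse (u + 1) := thueMorse.succ_of_even hu.add_one
  have hu1 := thueMorse.eq_one_or (u + 1)
  have hT1 : ∀ x < 2 ^ (v + 1), thueMorse (2 ^ (v + 1) * u + (2 ^ (v + 1) + x)) =
      thueMorse (u + 1) * thueMorse x := fun x hx ↦ by
    rw [← hadd _ _ hx]; congr 1; ring
  have hT2 : ∀ x < 2 ^ (v + 1), thueMorse (2 ^ (v + 1) * u + (2 * 2 ^ (v + 1) + x)) =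
      thueMorse (u + 2) * thueMorse x := fun x hx ↦ by
    rw [← hadd _ _ hx]; congr 1; ring
  have ht1 : ∀ x < 2 ^ (v + 1), thueMorse (2 ^ (v + 1) + x) = -thueMorse x := fun x hx ↦ by
    have := hadd 1 x hx
    rwa [mul_one, thueMorse.one, neg_one_mul] at this
  have ht2 : ∀ x < 2 ^ (v + 1), thueMorse (2 * 2 ^ (v + 1) + x) = -thueMorse x := fun x hx ↦ by
    have := hadd 2 x hx
    rwa [mul_comm, thueMorse.two, neg_one_mul] at this
  have hd1 : thueMorseDiff (2 ^ (v + 1) + 1) = 2 := by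
    rw [thueMorseDiff_of_odd hqe.add_one, ht1 1 (by omega), thueMorse.one]; rfl
  have hd2 : thueMorseDiff (2 * 2 ^ (v + 1) + 1) = 2 := by
    rw [thueMorseDiff_of_odd (even_two_mul _).add_one, ht2 1 (by omega), thueMorse.one]; rfl
  have heps : 2 ^ (v + 1) + 1 < k → thueMorse (u + 1) = -1 := fun h ↦ by
    have := hA _ (by omega) h (by omega)
    rw [hd1, hT1 1 (by omega), thueMorse.one] at this
    omega
  have hkle : k ≤ 2 * 2 ^ (v + 1) + 1 := by
    by_contra! h
    have h₁ := heps (by omega)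
    have := hA _ (by omega) h (by omega)
    rw [hd2, hT2 1 (by omega), thueMorse.one, hpair, h₁] at this
    omega
  have hdk : thueMorseDiff k ≠ 2 := fun h ↦ by
    have := hB (by omega)
    have := thueMorse.eq_one_or (2 ^ (v + 1) * u + k)
    omega
  have hk1 : k ≠ 2 ^ (v + 1) + 1 := fun h ↦ hdk (h ▸ hd1)
  have hk2 : k ≠ 2 * 2 ^ (v + 1) + 1 := fun h ↦ hdk (h ▸ hd2)
  rcases Nat.even_or_odd k with hke | hko
  · right
    have key : ∀ j, k + j + 1 < 2 ^ (v + 1) * u → thueMorse (k + j) = -thueMorse j := by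
      have hodd : ∀ j, Odd j → k + j < 2 ^ (v + 1) * u → thueMorse (k + j) = -thueMorse j := by
        intro j hj hlt
        have := hC (k + j) (by have := hj.pos; omega) hlt
        rw [Nat.add_sub_cancel_left, thueMorseDiff_of_odd hj,
          thueMorseDiff_of_odd (hke.add_odd hj)] at this
        have := thueMorse.eq_one_or j
        have := thueMorse.eq_one_or (k + j)
        have := thueMorse.eq_one_or (2 ^ (v + 1) * u + (k + j))
        omega
      intro j hlt
      rcases Nat.even_or_odd j with hj | hj
      · have h₁ := hodd (j + 1) hj.add_one (by omega)
        have h₂ := thueMorse.succ_of_even hj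
        have h₃ := thueMorse.succ_of_even (hke.add hj)
        rw [add_assoc] at h₃
        omega
      · exact hodd j hj (by omega)
    obtain ⟨a, w, hw, hk'⟩ := Nat.exists_eq_two_pow_mul_odd hk.ne'
    have hshift : ∀ e, k + 2 ^ a * e + 1 < 2 ^ (v + 1) * u →
        thueMorse (w + e) = -thueMorse e := by
      intro e he
      have := key _ he
      rwa [hk', ← mul_add, thueMorse.pow_mul, thueMorse.pow_mul] at this
    have hww : thueMorse (w + 2) = _ := thueMorse.succ_of_even hw.add_one
    have hsmall : ¬ k + 2 ^ a * 2 + 1 < 2 ^ (v + 1) * u := fun h ↦ by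
      have h₁ := hshift 1 (by omega)
      have h₂ := hshift 2 h
      rw [thueMorse.one] at h₁
      rw [thueMorse.two] at h₂
      omega
    have hw0 := hw.pos
    have haw : 2 ^ a ≤ k := by rw [hk']; exact Nat.le_mul_of_pos_right _ hw0
    have hav : v + 1 ≤ a := by
      by_contra! h
      have h' : 2 ^ a * 2 ≤ 2 ^ (v + 1) := by
        rw [← pow_succ]; exact Nat.pow_le_pow_right (by norm_num) h
      have hkne : k ≠ 2 * 2 ^ (v + 1) := by
        intro hk2
        have : a < v + 2 := by omega
        obtain ⟨b, hb⟩ := Nat.exists_eq_add_of_lt this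
        have : w = 2 * 2 ^ b := by
          apply Nat.eq_of_mul_eq_mul_left (show 0 < 2 ^ a by positivity)
          rw [← hk', hk2, ← hq2, hb]; ring
        exact Nat.not_even_iff_odd.2 hw ⟨2 ^ b, by omega⟩
      have : k ≠ 2 * 2 ^ (v + 1) - 1 := by rintro rfl; obtain ⟨c, hc⟩ := hke; omega
      omega
    obtain ⟨b, rfl⟩ := Nat.exists_eq_add_of_le hav
    have hbw : 2 ^ b * w ≤ 2 := by
      by_contra! h
      have : 2 ^ (v + 1) * 3 ≤ 2 ^ (v + 1) * (2 ^ b * w) := Nat.mul_le_mul_left _ h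
      rw [← mul_assoc, ← pow_add, ← hk'] at this
      omega
    have hkbw : k = 2 ^ (v + 1) * (2 ^ b * w) := by rw [hk', pow_add]; ring
    have hbw0 : 0 < 2 ^ b * w := by positivity
    obtain h1 | h2 : 2 ^ b * w = 1 ∨ 2 ^ b * w = 2 := by omega
    · rw [h1, mul_one] at hkbw
      have := key (2 ^ (v + 1)) (by omega)
      have h₁ := ht1 0 (by omega)
      have h₂ := ht2 0 (by omega)
      rw [add_zero, thueMorse.zero] at h₁ h₂
      rw [hkbw, ← _root_.two_mul, h₁, h₂] at this
      omega
    · rw [h2] at hkbw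
      refine ⟨v, ?_, by omega⟩
      by_contra hne
      have hu5 : 5 ≤ u := by
        have : u ≠ 3 := by rintro rfl; exact hne rfl
        obtain ⟨c, rfl⟩ := hu
        omega
      have hru : 2 ^ (v + 1) * 5 ≤ 2 ^ (v + 1) * u := Nat.mul_le_mul_left _ hu5
      have := key (2 * 2 ^ (v + 1)) (by omega)
      rw [hkbw, mul_comm 2, ← mul_add, thueMorse.pow_mul, thueMorse.pow_mul,
        show 2 + 2 = 2 * 2 from rfl, thueMorse.two_mul, thueMorse.two] at this
      omega
  · left
    rcases eq_or_ne v 0 with rfl | hv0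
    · obtain ⟨c, rfl⟩ := hko
      obtain ⟨w, rfl⟩ := hu
      omega
    · exfalso
      specialize hq4 hv0
      rcases hu1 with h1 | h1
      · have hlt : k < 2 ^ (v + 1) + 1 := by
          by_contra! h
          have := heps (by omega)
          omega
        refine false_of_shift_neg hko hqe.add_one hlt (hC _ hlt (by omega))
          (hC _ (by omega) (by omega)) ?_ ?_
        · rw [hT1 1 (by omega), ht1 1 (by omega), h1, one_mul, neg_neg]
        · rw [add_assoc, hT1 _ (by omega), ht1 _ (by omega), h1, one_mul, neg_neg]
      · have hlt : k < 2 * 2 ^ (v + 1) + 1 := by omega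
        refine false_of_shift_neg hko (even_two_mul _).add_one hlt (hC _ hlt (by omega))
          (hC _ (by omega) (by omega)) ?_ ?_
        · rw [hT2 1 (by omega), ht2 1 (by omega), hpair, h1, neg_neg, one_mul, neg_neg]
        · rw [add_assoc, hT2 _ (by omega), ht2 _ (by omega), hpair, h1, neg_neg, one_mul, neg_neg]

open Finset in
theorem two_mul_R_add (S : Set ℕ) (n : ℕ) :
    2 * (R S n : ℤ) + (if Even n then S.indicator 1 (n / 2) else 0) =
      ∑ p ∈ antidiagonal n, S.indicator 1 p.1 * S.indicator (1 : ℕ → ℤ) p.2 := by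
  classical
  have hR : (R S n : ℤ) = ∑ p ∈ antidiagonal n with p.1 < p.2,
      S.indicator 1 p.1 * S.indicator (1 : ℕ → ℤ) p.2 := by
    have : {p : ℕ × ℕ | p.1 ∈ S ∧ p.2 ∈ S ∧ p.1 < p.2 ∧ p.1 + p.2 = n} =
        ({p ∈ {p ∈ antidiagonal n | p.1 < p.2} | p.1 ∈ S ∧ p.2 ∈ S} : Finset (ℕ × ℕ)) := by
      ext p; simp; tauto
    rw [R, this, Set.ncard_coe_finset, natCast_card_filter]
    refine sum_congr rfl fun p _ ↦ ?_
    by_cases h₁ : p.1 ∈ S <;> by_cases h₂ : p.2 ∈ S <;> simp [h₁, h₂]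
  have hswap : ∑ p ∈ antidiagonal n with p.2 < p.1,
      S.indicator 1 p.1 * S.indicator (1 : ℕ → ℤ) p.2 = ∑ p ∈ antidiagonal n with p.1 < p.2,
      S.indicator 1 p.1 * S.indicator (1 : ℕ → ℤ) p.2 := by
    rw [sum_filter, sum_filter, ← Nat.sum_antidiagonal_swap]
    simp only [Prod.fst_swap, Prod.snd_swap, mul_comm]
  have hdiag : ∑ p ∈ antidiagonal n with p.1 = p.2,
      S.indicator 1 p.1 * S.indicator (1 : ℕ → ℤ) p.2 =
      if Even n then S.indicator 1 (n / 2) else 0 := by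
    split_ifs with hn
    · have : {p ∈ antidiagonal n | p.1 = p.2} = {(n / 2, n / 2)} := by
        ext ⟨a, b⟩
        obtain ⟨k, rfl⟩ := hn
        simp
        omega
      rw [this, sum_singleton]
      by_cases h : n / 2 ∈ S <;> simp [h]
    · refine sum_eq_zero fun p hp ↦ (hn ?_).elim
      rw [mem_filter, HasAntidiagonal.mem_antidiagonal] at hp
      exact ⟨p.1, by omega⟩
  rw [← hdiag, two_mul]
  nth_rw 1 [hR]
  rw [hR]
  nth_rw 1 [← hswap]
  rw [sum_filter, sum_filter, sum_filter, ← sum_add_distrib, ← sum_add_distrib]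
  refine sum_congr rfl fun p _ ↦ ?_
  rcases lt_trichotomy p.1 p.2 with h | h | h
  · simp [h, h.ne, h.not_gt]
  · simp [h]
  · simp [h, h.ne', h.not_gt]

/-- The shift of `f` by `r`, extended by zero. -/
def shiftZero (f : ℕ → ℤ) (r n : ℕ) : ℤ := if r ≤ n then f (n - r) else 0

open Finset in
theorem sum_antidiagonal_mul_ite (f : ℕ → ℤ) (r n : ℕ) :
    ∑ p ∈ antidiagonal n, f p.1 * (if p.2 = r then 1 else 0) = shiftZero f r n := by
  rw [shiftZero]
  split_ifs with h
  · rw [sum_eq_single (n - r, r)]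
    · simp
    · rintro ⟨a, b⟩ hab hne
      rw [HasAntidiagonal.mem_antidiagonal] at hab
      rw [if_neg (by rintro rfl; exact hne (by simp; omega)), mul_zero]
    · simp [h]
  · refine sum_eq_zero fun p hp ↦ ?_
    rw [HasAntidiagonal.mem_antidiagonal] at hp
    rw [if_neg (by omega), mul_zero]

open Finset in
theorem sum_range_add_shiftZero {r₁ r₂ m : ℕ} (hr : r₁ ≠ r₂) {C D : Set ℕ}
    (hU : C ∪ D = Set.Icc 0 m) (hI : C ∩ D = {r₁, r₂})
    (hR : ∀ n ≤ m, R C n = R D n) {f : ℕ → ℤ}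
    (hf : ∀ n, f n = C.indicator 1 n - D.indicator 1 n) {n : ℕ} (hn : n ≤ m) :
    ∑ i ∈ range (n + 1), f i + shiftZero f r₁ n + shiftZero f r₂ n =
      if Even n then f (n / 2) else 0 := by
  have hC := two_mul_R_add C n
  have hD := two_mul_R_add D n
  rw [hR n hn] at hC
  have hsum : ∀ k ≤ m, C.indicator 1 k + D.indicator (1 : ℕ → ℤ) k =
      1 + (if k = r₁ then 1 else 0) + (if k = r₂ then 1 else 0) := by
    intro k hk
    have h₁ : k ∈ C ∨ k ∈ D := by
      rw [← Set.mem_union, hU]; simpa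
    have h₂ : (k ∈ C ∧ k ∈ D) ↔ (k = r₁ ∨ k = r₂) := by
      rw [← Set.mem_inter_iff, hI]; simp
    by_cases h₃ : k ∈ C <;> by_cases h₄ : k ∈ D <;> simp [h₃, h₄] at h₁ h₂ ⊢ <;> grind
  have hcomm : ∑ p ∈ antidiagonal n, D.indicator 1 p.1 * C.indicator (1 : ℕ → ℤ) p.2 =
      ∑ p ∈ antidiagonal n, C.indicator 1 p.1 * D.indicator (1 : ℕ → ℤ) p.2 := by
    rw [← Nat.sum_antidiagonal_swap]
    simp only [Prod.fst_swap, Prod.snd_swap, mul_comm]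
  have hkey : ∑ p ∈ antidiagonal n, f p.1 * (1 + (if p.2 = r₁ then 1 else 0) +
      (if p.2 = r₂ then 1 else 0)) =
      ∑ p ∈ antidiagonal n, C.indicator 1 p.1 * C.indicator (1 : ℕ → ℤ) p.2 -
      ∑ p ∈ antidiagonal n, D.indicator 1 p.1 * D.indicator (1 : ℕ → ℤ) p.2 := by
    rw [← add_right_cancel_iff (a := ∑ p ∈ antidiagonal n,
      D.indicator 1 p.1 * C.indicator (1 : ℕ → ℤ) p.2)]
    nth_rw 2 [hcomm]
    rw [← sum_sub_distrib, ← sum_add_distrib, ← sum_add_distrib]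
    refine sum_congr rfl fun p hp ↦ ?_
    rw [HasAntidiagonal.mem_antidiagonal] at hp
    rw [← hsum _ (by omega), hf]
    ring
  simp only [mul_add, mul_one, sum_add_distrib, sum_antidiagonal_mul_ite] at hkey
  rw [Nat.sum_antidiagonal_eq_sum_range_succ_mk] at hkey
  simp only [Nat.succ_eq_add_one] at hkey
  rw [hkey, ← hC, ← hD, hf]
  split_ifs <;> ring

theorem thueMorse_div_two (n : ℕ) :
    thueMorse n = if Even n then thueMorse (n / 2) else -thueMorse (n / 2) := by
  obtain ⟨k, rfl | rfl⟩ := Nat.even_or_odd' n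
  · rw [if_pos (even_two_mul k), thueMorse.two_mul, Nat.mul_div_cancel_left k two_pos]
  · rw [if_neg (by grind), thueMorse.two_mul_add_one, show (2 * k + 1) / 2 = k by omega]

theorem stmt_10 (r₁ r₂ m : ℕ) (h₁ : 0 < r₁) (h₂ : r₁ < r₂) (h₃ : r₂ < r₁ + r₂)
    (h₄ : r₁ + r₂ ≤ m) (h₅ : Even r₁) (C D : Set ℕ)
    (hU : C ∪ D = Set.Icc 0 m) (hI : C ∩ D = {r₁, r₂}) (h0 : 0 ∈ C)
    (hR : ∀ n ≤ m, R C n = R D n) :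
    r₁ % 4 = 2 ∧ r₂ % 4 = 3 := by
  classical
  obtain ⟨f, hf⟩ : ∃ f : ℕ → ℤ, ∀ n, f n = C.indicator 1 n - D.indicator 1 n := ⟨_, fun _ ↦ rfl⟩
  have hmem : ∀ k, (k ∈ C ∧ k ∈ D) ↔ (k = r₁ ∨ k = r₂) := fun k ↦ by
    rw [← Set.mem_inter_iff, hI]; simp
  have hfr : ∀ k, k = r₁ ∨ k = r₂ → f k = 0 := fun k hk ↦ by
    obtain ⟨hC, hD⟩ := (hmem k).2 hk
    simp [hf, hC, hD]
  have hf1 : ∀ k ≤ m, k ≠ r₁ → k ≠ r₂ → f k = 1 ∨ f k = -1 := fun k hk hk₁ hk₂ ↦ by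
    have h : k ∈ C ∨ k ∈ D := by rw [← Set.mem_union, hU]; simpa
    have h' := hmem k
    by_cases hC : k ∈ C <;> by_cases hD : k ∈ D <;> simp_all
  have hf0 : f 0 = 1 := by
    have : 0 ∉ D := fun h ↦ by have := (hmem 0).1 ⟨h0, h⟩; omega
    simp [hf, h0, this]
  have hrec : ∀ n, n + 1 ≤ m → f (n + 1) + (shiftZero f r₁ (n + 1) - shiftZero f r₁ n) +
      (shiftZero f r₂ (n + 1) - shiftZero f r₂ n) =
      if Even (n + 1) then f ((n + 1) / 2) else -f ((n + 1) / 2) := fun n hn ↦ by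
    have e₁ := sum_range_add_shiftZero h₂.ne hU hI hR hf hn
    have e₂ := sum_range_add_shiftZero h₂.ne hU hI hR hf (Nat.le_of_succ_le hn)
    rw [Finset.sum_range_succ] at e₁
    rcases Nat.even_or_odd n with hn' | hn'
    · rw [if_neg (by grind)] at e₁ ⊢
      rw [if_pos hn'] at e₂
      rw [show (n + 1) / 2 = n / 2 by grind]
      linarith
    · rw [if_pos (by grind)] at e₁ ⊢
      rw [if_neg (by grind)] at e₂
      linarith
  have hlow : ∀ n < r₁, f n = thueMorse n := by
    intro n
    induction n using Nat.strong_induction_on with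
    | _ n ih =>
      intro hn
      rcases n with _ | n
      · rw [hf0, thueMorse.zero]
      · have := hrec n (by omega)
        rw [shiftZero, shiftZero, shiftZero, shiftZero, if_neg (by omega), if_neg (by omega),
          if_neg (by omega), if_neg (by omega), ih ((n + 1) / 2) (by omega) (by omega),
          ← thueMorse_div_two] at this
        linarith
  have hmid : ∀ n, 0 < n → n < 2 * r₁ → n ≤ m → f n +
      (shiftZero f r₁ n - shiftZero f r₁ (n - 1)) + (shiftZero f r₂ n - shiftZero f r₂ (n - 1)) =
      thueMorse n := by
    intro n hn hn' hnm
    obtain ⟨n, rfl⟩ := Nat.exists_eq_succ_of_ne_zero hn.ne'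
    rw [Nat.succ_eq_add_one] at *
    rw [Nat.add_sub_cancel, hrec n hnm, hlow _ (by omega), ← thueMorse_div_two]
  have hdiff : ∀ r, 0 < r → ∀ i < r₁,
      shiftZero f r (r + i) - shiftZero f r (r + i - 1) = thueMorseDiff i := by
    intro r hr i hi
    rcases i with _ | i
    · rw [shiftZero, shiftZero, if_pos (by omega), if_neg (by omega)]
      simp [hf0, thueMorseDiff]
    · rw [shiftZero, shiftZero, if_pos (by omega), if_pos (by omega), thueMorseDiff_succ,
        ← hlow _ hi, ← hlow i (by omega), Nat.add_sub_cancel_left,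
        show r + (i + 1) - 1 - r = i by omega]
  have hzero : ∀ r n, n < r → shiftZero f r n = 0 := fun r n h ↦ if_neg (by omega)
  obtain ⟨k, rfl⟩ := Nat.exists_eq_add_of_lt h₂
  have hlt : ∀ i < r₁, i < k + 1 → f (r₁ + i) = thueMorse (r₁ + i) - thueMorseDiff i := by
    intro i hi hik
    have := hmid (r₁ + i) (by omega) (by omega) (by omega)
    rw [hdiff _ h₁ _ hi, hzero _ _ (by omega), hzero _ _ (by omega)] at this
    linarith
  have hge : ∀ i < r₁, k + 1 ≤ i → f (r₁ + i) =
      thueMorse (r₁ + i) - thueMorseDiff i - thueMorseDiff (i - (k + 1)) := by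
    intro i hi hik
    have := hmid (r₁ + i) (by omega) (by omega) (by omega)
    have h := hdiff (r₁ + k + 1) (by omega) (i - (k + 1)) (by omega)
    rw [show r₁ + k + 1 + (i - (k + 1)) = r₁ + i by omega] at h
    rw [hdiff _ h₁ _ hi, h] at this
    linarith
  have hmorse : thueMorse r₁ = 1 := by
    have := hlt 0 h₁ (by omega)
    rw [add_zero, hfr _ (Or.inl rfl), thueMorseDiff] at this
    linarith
  have hA : ∀ i, 0 < i → i < k + 1 → i < r₁ →
      thueMorse (r₁ + i) - thueMorseDiff i = 1 ∨ thueMorse (r₁ + i) - thueMorseDiff i = -1 := by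
    intro i hi hik hir
    rw [← hlt i hir hik]
    exact hf1 _ (by omega) (by omega) (by omega)
  have hB : k + 1 < r₁ → thueMorse (r₁ + (k + 1)) - thueMorseDiff (k + 1) = 1 := by
    intro hkr
    have := hge _ hkr le_rfl
    rw [hfr _ (Or.inr (by omega)), Nat.sub_self, thueMorseDiff] at this
    linarith
  have hC : ∀ i, k + 1 < i → i < r₁ →
      thueMorse (r₁ + i) - thueMorseDiff i - thueMorseDiff (i - (k + 1)) = 1 ∨
      thueMorse (r₁ + i) - thueMorseDiff i - thueMorseDiff (i - (k + 1)) = -1 := by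
    intro i hik hir
    rw [← hge i hir hik.le]
    exact hf1 _ (by omega) (by omega) (by omega)
  obtain ⟨h, h'⟩ | ⟨v, hr, hk⟩ := shift_cases h₁ k.succ_pos h₅ hmorse hA hB hC
  · omega
  · exfalso
    have hq : 0 < 2 ^ (v + 1) := by positivity
    have hqe : Even (2 ^ (v + 1)) := by simp [Nat.even_pow]
    have hq2 : 2 ^ (v + 2) = 2 * 2 ^ (v + 1) := by ring
    have hdq := hdiff (r₁ + k + 1) (by omega) (2 ^ (v + 1) + 1) (by omega)
    rw [show r₁ + k + 1 + (2 ^ (v + 1) + 1) = 2 * r₁ + 1 by omega, Nat.add_sub_cancel,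
      thueMorseDiff_of_odd hqe.add_one, thueMorse.succ_of_even hqe, ← mul_one (2 ^ (v + 1)),
      thueMorse.pow_mul, thueMorse.one] at hdq
    have hf₁ := hlt 1 (by omega) (by omega)
    rw [thueMorseDiff_of_odd odd_one, thueMorse.one, thueMorse.succ_of_even h₅, hmorse] at hf₁
    have := hrec (2 * r₁) (by omega)
    rw [hdq, if_neg (by grind), show (2 * r₁ + 1) / 2 = r₁ by omega, shiftZero, shiftZero,
      if_pos (by omega), if_pos (by omega), show 2 * r₁ + 1 - r₁ = r₁ + 1 by omega,
      show 2 * r₁ - r₁ = r₁ by omega, hf₁, hfr r₁ (Or.inl rfl)] at this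
    have := hf1 (2 * r₁ + 1) (by omega) (by omega) (by omega)
    omega
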